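/- Let n ≥ 5 and let N be a perfect group of order n! whose center Z(N) has exactly two elements. Suppose f : Sₙ → Aut(N) is a group homomorphism and g : Sₙ → N is a bijective map satisfying g(στ) = g(σ) · f(σ)(g(τ)) for all σ, τ ∈ Sₙ, and let f̃ : Aₙ → N be an injective map with f(σ)(η) = f̃(σ) · η · f̃(σ)⁻¹ for all σ ∈ Aₙ and η ∈ N. Let ζ ∈ Sₙ be the unique element with g(ζ) equal to the nontrivial element of Z(N), and assume ζ ∈ Aₙ. Then: (i) for every σ ∈ Sₙ, one has σζ = ζσ if and only if f̃(ζ)·g(σ) = g(σ)·f̃(ζ); and (ii) ζ has order two. -/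

import Mathlib

theorem stmt_12 (n : ℕ) (hn : 5 ≤ n) (N : Type*) [Group N]
    (hcard : Nat.card N = n.factorial) (hperf : commutator N = ⊤)
    (hZ : Nat.card (Subgroup.center N) = 2)
    (f : Equiv.Perm (Fin n) →* MulAut N)
    (g : Equiv.Perm (Fin n) → N) (hg : Function.Bijective g)
    (hfg : ∀ σ τ : Equiv.Perm (Fin n), g (σ * τ) = g σ * f σ (g τ))
    (ft : alternatingGroup (Fin n) → N) (hft : Function.Injective ft)
    (hftconj : ∀ (σ : alternatingGroup (Fin n)) (η : N),
      f (σ : Equiv.Perm (Fin n)) η = ft σ * η * (ft σ)⁻¹)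
    (ζ : Equiv.Perm (Fin n)) (hζc : g ζ ∈ Subgroup.center N) (hζ1 : g ζ ≠ 1)
    (hζA : ζ ∈ alternatingGroup (Fin n)) :
    (∀ σ : Equiv.Perm (Fin n),
        σ * ζ = ζ * σ ↔ ft ⟨ζ, hζA⟩ * g σ = g σ * ft ⟨ζ, hζA⟩) ∧
      orderOf ζ = 2 := by
  obtain ⟨y, hy, huniq⟩ := (Nat.card_eq_two_iff' (1 : Subgroup.center N)).1 hZ
  have key : ∀ w : N, w ∈ Subgroup.center N → w ≠ 1 → w = g ζ := by
    intro w hw hw1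
    have h1 := huniq ⟨w, hw⟩ (fun h => hw1 (congrArg Subtype.val h))
    have h2 := huniq ⟨g ζ, hζc⟩ (fun h => hζ1 (congrArg Subtype.val h))
    exact congrArg Subtype.val (h1.trans h2.symm)
  have hcomm : ∀ x : N, x * g ζ = g ζ * x := Subgroup.mem_center_iff.1 hζc
  have hfix : ∀ φ : MulAut N, φ (g ζ) = g ζ := by
    intro φ
    apply key
    · rw [Subgroup.mem_center_iff]
      intro x
      obtain ⟨t, rfl⟩ := φ.surjective x
      rw [← map_mul, ← map_mul, hcomm]
    · intro h
      exact hζ1 ((map_eq_one_iff φ φ.injective).1 h)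
  have hsq : g ζ * g ζ = 1 := by
    by_contra h
    have := key _ (mul_mem hζc hζc) h
    exact hζ1 (mul_eq_left.1 this)
  have hg1 : g 1 = 1 := by
    have h := hfg 1 1
    rw [map_one, mul_one, MulAut.one_apply] at h
    exact mul_eq_left.1 h.symm
  refine ⟨fun σ => ?_, ?_⟩
  · rw [← hg.injective.eq_iff, hfg, hfg, hfix, hcomm, mul_right_inj]
    have := hftconj ⟨ζ, hζA⟩ (g σ)
    simp only at this
    rw [this, eq_mul_inv_iff_mul_eq, eq_comm]
  · refine orderOf_eq_prime ?_ ?_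
    · apply hg.injective
      rw [pow_two, hfg, hfix, hsq, hg1]
    · rintro rfl
      exact hζ1 hg1
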